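/- Let G be an infinite group and let F ⊆ G be a finite symmetric subset with 1 ∉ F. Then there exists a subset A ⊆ G such that the Cayley graph Cay(G, ∂A) is well-covered if and only if all maximal cliques of Δ(F) have the same cardinality. -/

import Mathlib

open Pointwise

/-- The (left) Cayley graph of `G` with connection set `S`:
distinct `g, h` are adjacent iff `g * h⁻¹ ∈ S` (for symmetric `S`). -/
def cayley (G : Type*) [Group G] (S : Set G) : SimpleGraph G :=
  SimpleGraph.fromRel (fun g h => g * h⁻¹ ∈ S)

/-- The graph `Δ(F)` on vertex set `F`: distinct `u, v ∈ F` are adjacent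
iff `u * v⁻¹ ∈ F` (for symmetric `F`). -/
def delta {G : Type*} [Group G] (F : Set G) : SimpleGraph F :=
  SimpleGraph.fromRel (fun u v => (u : G) * (v : G)⁻¹ ∈ F)

/-- Condition (SF1): the product `A * U` is direct. -/
def SF1 {G : Type*} [Group G] (A U : Set G) : Prop :=
  ∀ a ∈ A, ∀ b ∈ A, ∀ u ∈ U, ∀ v ∈ U, a * u = b * v → a = b ∧ u = v

/-- `U` is a right s-factor of `G` associated with `A`: `U` satisfies (SF1) for `A`
and is maximal with respect to inclusion among subsets satisfying (SF1) for `A`. -/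
def IsRightSFactor {G : Type*} [Group G] (A U : Set G) : Prop :=
  SF1 A U ∧ ∀ W : Set G, SF1 A W → U ⊆ W → W = U

/-- `s` is an independent set of vertices of `Γ`. -/
def IsIndep {V : Type*} (Γ : SimpleGraph V) (s : Set V) : Prop :=
  ∀ u ∈ s, ∀ v ∈ s, ¬ Γ.Adj u v

/-- `s` is a maximal independent set of `Γ`. -/
def IsMaxIndep {V : Type*} (Γ : SimpleGraph V) (s : Set V) : Prop :=
  IsIndep Γ s ∧ ∀ t : Set V, IsIndep Γ t → s ⊆ t → t = s

/-- `s` is a maximal clique of `Γ`. -/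
def IsMaxClique {V : Type*} (Γ : SimpleGraph V) (s : Set V) : Prop :=
  Γ.IsClique s ∧ ∀ t : Set V, Γ.IsClique t → s ⊆ t → t = s

/-- A graph is well-covered if all its maximal independent sets have the same cardinality. -/
def WellCovered {V : Type*} (Γ : SimpleGraph V) : Prop :=
  ∀ s t : Set V, IsMaxIndep Γ s → IsMaxIndep Γ t → Cardinal.mk s = Cardinal.mk t

/-- An infinite type carries a well-order all of whose proper initial segments are
strictly smaller than the whole type. -/
theorem exists_isWellOrder_mk_lt (α : Type*) :
    ∃ r : α → α → Prop, IsWellOrder α r ∧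
      ∀ x, Cardinal.mk {y // r y x} < Cardinal.mk α := by
  obtain ⟨r, hr, h⟩ := Cardinal.exists_ord_eq α
  exact ⟨r, hr, fun x => by simpa using Cardinal.card_typein_lt (r := r) x h⟩

/-- In an infinite group, the complement of a finite symmetric set avoiding `1` is a
difference set `A⁻¹ * A`. -/
theorem exists_inv_mul_self_eq_compl {G : Type*} [Group G] [Infinite G] {F : Set G}
    (hfin : F.Finite) (hsym : F⁻¹ = F) (h1 : (1 : G) ∉ F) :
    ∃ A : Set G, A⁻¹ * A = Fᶜ := by
  classical
  obtain ⟨r, hr, hlt⟩ := exists_isWellOrder_mk_lt G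
  have hwf : WellFounded r := hr.toIsWellFounded.wf
  let forbidden (g : G) (ih : ∀ h, r h g → G) (p : {h // r h g} × (F × Bool × Bool)) : G :=
    ih p.1 p.1.2 * (if p.2.2.1 then p.1.1 else 1) * p.2.1 * (if p.2.2.2 then g else 1)⁻¹
  have hex : ∀ g ih, ∃ a, a ∉ Set.range (forbidden g ih) := by
    intro g ih
    by_contra! hall
    have hle := Cardinal.mk_le_of_surjective (f := forbidden g ih) hall
    refine hle.not_gt ?_
    have := hfin.to_subtype
    rw [Cardinal.mk_prod, Cardinal.lift_id, Cardinal.lift_id]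
    exact Cardinal.mul_lt_of_lt (Cardinal.aleph0_le_mk G) (hlt g)
      ((Cardinal.lt_aleph0_of_finite _).trans_le (Cardinal.aleph0_le_mk G))
  let f : G → G := hwf.fix fun g ih => (hex g ih).choose
  have hf : ∀ g, f g ∉ Set.range (forbidden g fun h _ => f h) := by
    intro g
    have h := (hex g fun h _ => f h).choose_spec
    rwa [← hwf.fix_eq (fun g ih => (hex g ih).choose) g] at h
  have key : ∀ g h, r h g → ∀ b c : Bool,
      (f h * (if b then h else 1))⁻¹ * (f g * (if c then g else 1)) ∉ F := by
    intro g h hgh b c hF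
    refine hf g ⟨(⟨h, hgh⟩, ⟨_, hF⟩, b, c), ?_⟩
    simp only [forbidden]
    group
  have hinv : ∀ {x : G}, x⁻¹ ∈ F → x ∈ F := fun {x} hx => by
    rw [← hsym]; exact hx
  refine ⟨{x | ∃ g ∉ F, ∃ b : Bool, x = f g * (if b then g else 1)}, ?_⟩
  ext x
  constructor
  · rintro ⟨y, ⟨h, hh, b, hy⟩, z, ⟨g, hg, c, rfl⟩, rfl⟩ hF
    obtain rfl := inv_eq_iff_eq_inv.mp hy
    simp only at hF
    rcases trichotomous_of r h g with hlt | rfl | hlt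
    · exact key g h hlt b c hF
    · cases b <;> cases c <;> simp at hF
      · exact h1 hF
      · exact hg hF
      · exact hg (hinv hF)
      · exact h1 (by simpa using hF)
    · refine key h g hlt c b (hinv ?_)
      convert hF using 1
      group
  · intro hx
    exact ⟨(f x)⁻¹, ⟨x, hx, false, by simp⟩, f x * x, ⟨x, hx, true, by simp⟩, by simp⟩

section Correspondence

variable {G : Type*} [Group G] {F : Set G}

theorem mul_inv_mem_comm (hsym : F⁻¹ = F) {u v : G} : u * v⁻¹ ∈ F ↔ v * u⁻¹ ∈ F := by
  rw [← hsym, Set.mem_inv]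
  simp [hsym]

theorem isIndep_cayley_compl_iff {s : Set G} :
    IsIndep (cayley G (Fᶜ \ {1})) s ↔ s.Pairwise fun u v => u * v⁻¹ ∈ F := by
  constructor
  · intro h u hu v hv huv
    by_contra hF
    exact h u hu v hv ((SimpleGraph.fromRel_adj _ _ _).mpr
      ⟨huv, Or.inl ⟨hF, by simpa [mul_inv_eq_one] using huv⟩⟩)
  · intro h u hu v hv hadj
    obtain ⟨huv, hF | hF⟩ := (SimpleGraph.fromRel_adj _ _ _).mp hadj
    · exact hF.1 (h hu hv huv)
    · exact hF.1 (h hv hu huv.symm)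

theorem isClique_delta_iff (hsym : F⁻¹ = F) {Q : Set F} :
    (delta F).IsClique Q ↔ Q.Pairwise fun u v => (u : G) * (v : G)⁻¹ ∈ F := by
  constructor
  · intro h u hu v hv huv
    obtain ⟨-, hF | hF⟩ := (SimpleGraph.fromRel_adj _ _ _).mp (h hu hv huv)
    · exact hF
    · exact (mul_inv_mem_comm hsym).mp hF
  · intro h u hu v hv huv
    exact (SimpleGraph.fromRel_adj _ _ _).mpr ⟨huv, Or.inl (h hu hv huv)⟩

theorem isIndep_insert_one_iff (hsym : F⁻¹ = F) {Q : Set F} :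
    IsIndep (cayley G (Fᶜ \ {1})) (insert 1 (Subtype.val '' Q)) ↔ (delta F).IsClique Q := by
  rw [isIndep_cayley_compl_iff, isClique_delta_iff hsym]
  constructor
  · intro h u hu v hv huv
    exact h (.inr ⟨u, hu, rfl⟩) (.inr ⟨v, hv, rfl⟩) (Subtype.coe_injective.ne huv)
  · rintro h u (rfl | ⟨u, hu, rfl⟩) v (rfl | ⟨v, hv, rfl⟩) huv
    · exact absurd rfl huv
    · exact (mul_inv_mem_comm hsym).mp (by simp)
    · simp
    · exact h hu hv fun e => huv (congrArg _ e)

theorem eq_insert_one_of_isIndep {s : Set G}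
    (hs : IsIndep (cayley G (Fᶜ \ {1})) s) (h1s : (1 : G) ∈ s) :
    s = insert 1 (Subtype.val '' (Subtype.val ⁻¹' s : Set F)) := by
  rw [isIndep_cayley_compl_iff] at hs
  ext x
  constructor
  · intro hx
    by_cases hx1 : x = 1
    · exact .inl hx1
    · exact .inr ⟨⟨x, by simpa using hs hx h1s hx1⟩, hx, rfl⟩
  · rintro (rfl | ⟨x, hx, rfl⟩)
    · exact h1s
    · exact hx

theorem preimage_insert_one (h1 : (1 : G) ∉ F) (Q : Set F) :
    (Subtype.val ⁻¹' insert 1 (Subtype.val '' Q) : Set F) = Q := by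
  ext x
  have : (x : G) ≠ 1 := fun e => h1 (e ▸ x.2)
  simp [this]

theorem isMaxIndep_insert_one_iff (hsym : F⁻¹ = F) (h1 : (1 : G) ∉ F) {Q : Set F} :
    IsMaxIndep (cayley G (Fᶜ \ {1})) (insert 1 (Subtype.val '' Q)) ↔
      IsMaxClique (delta F) Q := by
  refine and_congr (isIndep_insert_one_iff hsym) ⟨fun h T hT hQT => ?_, fun h t ht hQt => ?_⟩
  · rw [← preimage_insert_one h1 T, h _ ((isIndep_insert_one_iff hsym).mpr hT)
      (Set.insert_subset_insert (Set.image_mono hQT)), preimage_insert_one h1 Q]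
  · have heq := eq_insert_one_of_isIndep ht (hQt (.inl rfl))
    have hpre := h (Subtype.val ⁻¹' t) ((isIndep_insert_one_iff hsym).mp (heq ▸ ht))
      fun x hx => hQt (.inr ⟨x, hx, rfl⟩)
    rw [heq, hpre]

theorem mk_insert_one (h1 : (1 : G) ∉ F) (Q : Set F) :
    Cardinal.mk (insert 1 (Subtype.val '' Q) : Set G) = Cardinal.mk Q + 1 := by
  rw [Cardinal.mk_insert, Cardinal.mk_image_eq Subtype.coe_injective]
  rintro ⟨x, -, hx⟩
  exact h1 (hx ▸ x.2)

theorem isIndep_mul_right {S s : Set G} (hs : IsIndep (cayley G S) s) (g : G) :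
    IsIndep (cayley G S) ((· * g) '' s) := by
  rintro _ ⟨u, hu, rfl⟩ _ ⟨v, hv, rfl⟩ hadj
  refine hs u hu v hv ?_
  simpa [cayley, SimpleGraph.fromRel_adj] using hadj

theorem isMaxIndep_mul_right {S s : Set G} (hs : IsMaxIndep (cayley G S) s) (g : G) :
    IsMaxIndep (cayley G S) ((· * g) '' s) := by
  refine ⟨isIndep_mul_right hs.1 g, fun t ht hst => ?_⟩
  rw [← hs.2 _ (isIndep_mul_right ht g⁻¹) fun x hx => ⟨x * g, hst ⟨x, hx, rfl⟩, by simp⟩]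
  simp only [Set.image_image, inv_mul_cancel_right, Set.image_id']

theorem exists_isMaxClique_of_isMaxIndep (hsym : F⁻¹ = F) (h1 : (1 : G) ∉ F) {s : Set G}
    (hs : IsMaxIndep (cayley G (Fᶜ \ {1})) s) :
    ∃ Q : Set F, IsMaxClique (delta F) Q ∧ Cardinal.mk s = Cardinal.mk Q + 1 := by
  have hne : s.Nonempty := by
    by_contra! he
    have := hs.2 {1} ((isIndep_cayley_compl_iff).mpr (Set.pairwise_singleton _ _))
      (by simp [he])
    simp [he] at this
  obtain ⟨g, hg⟩ := hne
  have hs' := isMaxIndep_mul_right hs g⁻¹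
  have heq := eq_insert_one_of_isIndep hs'.1 ⟨g, hg, by simp⟩
  refine ⟨_, (isMaxIndep_insert_one_iff hsym h1).mp (heq ▸ hs'), ?_⟩
  rw [← mk_insert_one h1, ← heq, Cardinal.mk_image_eq (mul_left_injective g⁻¹)]

theorem wellCovered_cayley_compl_iff (hsym : F⁻¹ = F) (h1 : (1 : G) ∉ F) :
    WellCovered (cayley G (Fᶜ \ {1})) ↔
      ∀ Q₁ Q₂ : Set F, IsMaxClique (delta F) Q₁ → IsMaxClique (delta F) Q₂ →
        Cardinal.mk Q₁ = Cardinal.mk Q₂ := by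
  constructor
  · intro h Q₁ Q₂ h₁ h₂
    have := h _ _ ((isMaxIndep_insert_one_iff hsym h1).mpr h₁)
      ((isMaxIndep_insert_one_iff hsym h1).mpr h₂)
    rwa [mk_insert_one h1, mk_insert_one h1, Cardinal.add_one_inj] at this
  · intro h s t hs ht
    obtain ⟨Q₁, h₁, e₁⟩ := exists_isMaxClique_of_isMaxIndep hsym h1 hs
    obtain ⟨Q₂, h₂, e₂⟩ := exists_isMaxClique_of_isMaxIndep hsym h1 ht
    rw [e₁, e₂, h Q₁ Q₂ h₁ h₂]

end Correspondence

/-- For every finite symmetric `F` not containing `1` in an infinite group `G`,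
there is `A ⊆ G` such that `Cay(G, ∂A)` is well-covered iff all maximal cliques of
`Δ(F)` have the same cardinality. -/
theorem exists_A_wellCovered_iff (G : Type*) [Group G] [Infinite G] (F : Set G)
    (hfin : F.Finite) (hsym : F⁻¹ = F) (h1 : (1 : G) ∉ F) :
    ∃ A : Set G,
      (WellCovered (cayley G ((A⁻¹ * A) \ {1})) ↔
        ∀ Q₁ Q₂ : Set F, IsMaxClique (delta F) Q₁ → IsMaxClique (delta F) Q₂ →
          Cardinal.mk Q₁ = Cardinal.mk Q₂) := by
  obtain ⟨A, hA⟩ := exists_inv_mul_self_eq_compl hfin hsym h1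
  exact ⟨A, hA ▸ wellCovered_cayley_compl_iff hsym h1⟩
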